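/- Let K be a field and let 𝒞₄ be the uniform admissible clutter in the standard model with height g = 4 and d = 5 color classes whose edge set consists of the four constant functions together with the four monotone functions (written as 5-tuples of values in {1,2,3,4}): (1,2,3,3,4), (1,1,2,2,3), (1,1,3,3,3), and (1,2,2,2,4). Then the Alexander dual ideal I(𝒞₄)^∨ in MvPolynomial ((Fin 4) × (Fin 5)) K, generated by the squarefree monomials ∏_{v ∈ C} X_v as C ranges over the minimal vertex covers of 𝒞₄, does not have linear quotients: for every enumeration u_1, ..., u_r of its minimal monomial generators there exists 1 ≤ i ≤ r−1 such that the colon ideal ((u_1, ..., u_i) : u_{i+1}) is not generated by variables. -/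

import Mathlib

/-- A subset `C` of the vertex set `(Fin g) × (Fin d)` is a vertex cover of the
clutter given by the edge set `E` if it meets every edge. -/
def IsCover {g d : ℕ} (E : Set (Fin d → Fin g)) (C : Finset (Fin g × Fin d)) : Prop :=
  ∀ f ∈ E, ∃ i : Fin d, (f i, i) ∈ C

/-- A minimal vertex cover: a vertex cover no proper subset of which is a vertex cover. -/
def IsMinCover {g d : ℕ} (E : Set (Fin d → Fin g)) (C : Finset (Fin g × Fin d)) : Prop :=
  IsCover E C ∧ ∀ C' ⊂ C, ¬ IsCover E C'

/-- The squarefree monomial `∏_{v ∈ C} X_v` associated to a set of vertices `C`. -/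
noncomputable def CoverMonomial (K : Type*) [CommRing K] {g d : ℕ}
    (C : Finset (Fin g × Fin d)) : MvPolynomial (Fin g × Fin d) K :=
  ∏ v ∈ C, MvPolynomial.X v

/-- A (finite) set `G` of monomials, generating a monomial ideal in a single degree,
has linear quotients if its elements can be enumerated as `u_1, …, u_r` so that for
each `i ≥ 1` the colon ideal `((u_1, …, u_i) : u_{i+1})` is generated by variables. -/
def HasLinearQuotients {V K : Type*} [CommRing K]
    (G : Set (MvPolynomial V K)) : Prop :=
  ∃ L : List (MvPolynomial V K), L.Nodup ∧ {u | u ∈ L} = G ∧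
    ∀ i : ℕ, ∀ hi : i < L.length, 0 < i →
      ∃ S : Set V,
        Submodule.colon (Ideal.span {u | u ∈ L.take i}) (Ideal.span {L.get ⟨i, hi⟩}) =
          Ideal.span (MvPolynomial.X '' S)

/-- The counterexample clutter `𝒞₄` with height `g = 4` and `d = 5` color classes:
its edges are the four constant functions together with the four monotone functions
(1,2,3,3,4), (1,1,2,2,3), (1,1,3,3,3), (1,2,2,2,4) (written here 0-indexed). -/
def ClutterC4 : Set (Fin 5 → Fin 4) :=
  {f | (∃ j : Fin 4, f = fun _ => j) ∨
    f = ![0, 1, 2, 2, 3] ∨ f = ![0, 0, 1, 1, 2] ∨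
    f = ![0, 0, 2, 2, 2] ∨ f = ![0, 1, 1, 1, 3]}

theorem coverMonomial_eq_monomial (K : Type*) [CommRing K] {g d : ℕ}
    (C : Finset (Fin g × Fin d)) :
    CoverMonomial K C = MvPolynomial.monomial (∑ v ∈ C, Finsupp.single v 1) 1 := by
  rw [MvPolynomial.monomial_sum_one]
  rfl

theorem sum_single_one_apply {V : Type*} [DecidableEq V] (C : Finset V) (v : V) :
    (∑ w ∈ C, Finsupp.single w 1 : V →₀ ℕ) v = if v ∈ C then 1 else 0 := by
  simp [Finsupp.finsetSum_apply, Finsupp.single_apply]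

theorem sum_single_one_le_iff {V : Type*} [DecidableEq V] {C D : Finset V} :
    (∑ w ∈ D, Finsupp.single w 1 : V →₀ ℕ) ≤ ∑ w ∈ C, Finsupp.single w 1 ↔ D ⊆ C := by
  simp only [Finsupp.le_def, sum_single_one_apply]
  refine forall_congr' fun v => ?_
  split_ifs <;> simp_all

theorem coverMonomial_mem_span_image_iff {K : Type*} [Field K] {g d : ℕ}
    {T : Set (Finset (Fin g × Fin d))} {C : Finset (Fin g × Fin d)} :
    CoverMonomial K C ∈ Ideal.span (CoverMonomial K '' T) ↔ ∃ D ∈ T, D ⊆ C := by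
  have himage : CoverMonomial K '' T =
      (fun s => MvPolynomial.monomial s (1 : K)) ''
        ((fun D => ∑ v ∈ D, Finsupp.single v 1) '' T) := by
    rw [Set.image_image]
    exact Set.image_congr fun D _ => coverMonomial_eq_monomial K D
  classical
  rw [himage, MvPolynomial.mem_ideal_span_monomial_image, coverMonomial_eq_monomial,
    MvPolynomial.support_monomial]
  simp [sum_single_one_le_iff]

theorem coverMonomial_mem_span_X_image {K : Type*} [Field K] {g d : ℕ}
    {S : Set (Fin g × Fin d)} {C : Finset (Fin g × Fin d)}
    (h : CoverMonomial K C ∈ Ideal.span (MvPolynomial.X '' S)) : ∃ v ∈ S, v ∈ C := by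
  classical
  rw [MvPolynomial.mem_ideal_span_X_image, coverMonomial_eq_monomial,
    MvPolynomial.support_monomial] at h
  simpa [sum_single_one_apply] using h

theorem mem_colon_span_singleton_iff_mul_mem {R : Type*} [CommRing R] {I : Ideal R} {u p : R} :
    p ∈ Submodule.colon I (Ideal.span {u} : Ideal R) ↔ p * u ∈ I := by
  rw [Submodule.mem_colon]
  refine ⟨fun h => h u (Ideal.mem_span_singleton_self u), fun h s hs => ?_⟩
  obtain ⟨q, rfl⟩ := Ideal.mem_span_singleton'.1 hs
  rw [smul_eq_mul, mul_left_comm]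
  exact I.mul_mem_left q h

/-- If the colon ideal of the cover monomials of `T` by that of `B` is generated by variables, then
for each `A ∈ T` some member of `T` is contained in `B` with one vertex of `A \ B` added. -/
theorem exists_subset_insert_of_colon_eq_span_X {K : Type*} [Field K] {g d : ℕ}
    {T : Set (Finset (Fin g × Fin d))} {A B : Finset (Fin g × Fin d)} {S : Set (Fin g × Fin d)}
    (hA : A ∈ T)
    (h : Submodule.colon (Ideal.span (CoverMonomial K '' T)) (Ideal.span {CoverMonomial K B}) =
      Ideal.span (MvPolynomial.X '' S)) :
    ∃ v ∈ A \ B, ∃ D ∈ T, D ⊆ insert v B := by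
  have hdiff : CoverMonomial K (A \ B) ∈ Ideal.span (MvPolynomial.X '' S) := by
    rw [← h, mem_colon_span_singleton_iff_mul_mem, CoverMonomial, CoverMonomial,
      ← Finset.prod_union Finset.sdiff_disjoint]
    exact coverMonomial_mem_span_image_iff.2
      ⟨A, hA, by rw [Finset.sdiff_union_self_eq_union]; exact Finset.subset_union_left⟩
  obtain ⟨v, hvS, hv⟩ := coverMonomial_mem_span_X_image hdiff
  have hX : (MvPolynomial.X v : MvPolynomial (Fin g × Fin d) K) ∈
      Ideal.span (MvPolynomial.X '' S) := Ideal.subset_span ⟨v, hvS, rfl⟩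
  rw [← h, mem_colon_span_singleton_iff_mul_mem, CoverMonomial,
    ← Finset.prod_insert (Finset.mem_sdiff.1 hv).2] at hX
  exact ⟨v, hv, coverMonomial_mem_span_image_iff.1 hX⟩

theorem coverMonomial_injective (K : Type*) [Field K] {g d : ℕ} :
    Function.Injective (CoverMonomial K : Finset (Fin g × Fin d) → _) := by
  intro C D h
  rw [coverMonomial_eq_monomial, coverMonomial_eq_monomial] at h
  have hexp := MvPolynomial.monomial_left_injective one_ne_zero h
  exact (sum_single_one_le_iff.1 hexp.le).antisymm (sum_single_one_le_iff.1 hexp.ge)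

/-- If `A` and `B` are the only members of `F` contained in `A ∪ B` and both differences have at
least two elements, then the cover monomials of `F` do not have linear quotients. -/
theorem not_hasLinearQuotients_image_coverMonomial {K : Type*} [Field K] {g d : ℕ}
    {F : Set (Finset (Fin g × Fin d))} {A B : Finset (Fin g × Fin d)} (hA : A ∈ F) (hB : B ∈ F)
    (hAB : 1 < (A \ B).card) (hBA : 1 < (B \ A).card)
    (honly : ∀ D ∈ F, D ⊆ A ∪ B → D = A ∨ D = B) :
    ¬ HasLinearQuotients (CoverMonomial K '' F) := by
  rintro ⟨L, hL, hLF, hcolon⟩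
  have hmem : ∀ u, u ∈ L ↔ u ∈ CoverMonomial K '' F := fun u => Set.ext_iff.1 hLF u
  have key : ∀ (A B : Finset (Fin g × Fin d)), 1 < (A \ B).card →
      (∀ D ∈ F, D ⊆ A ∪ B → D = A ∨ D = B) → A ∈ F →
      ∀ i j (hi : i < L.length) (hj : j < L.length),
      L[i] = CoverMonomial K A → L[j] = CoverMonomial K B → ¬ i < j := by
    intro A B hAB honly hA i j hi hj hLi hLj hij
    obtain ⟨S, hS⟩ := hcolon j hj (by omega)
    have htake : {u | u ∈ L.take j} =
        CoverMonomial K '' {D | D ∈ F ∧ CoverMonomial K D ∈ L.take j} := by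
      ext u
      constructor
      · intro hu
        obtain ⟨D, hD, rfl⟩ := (hmem u).1 (List.mem_of_mem_take hu)
        exact ⟨D, ⟨hD, hu⟩, rfl⟩
      · rintro ⟨D, hD, rfl⟩
        exact hD.2
    rw [htake, List.get_eq_getElem, hLj] at hS
    have hAL : A ∈ {D | D ∈ F ∧ CoverMonomial K D ∈ L.take j} :=
      ⟨hA, List.mem_take_iff_getElem.2 ⟨i, by omega, hLi⟩⟩
    obtain ⟨v, hv, D, ⟨hDF, hDL⟩, hDv⟩ := exists_subset_insert_of_colon_eq_span_X hAL hS
    obtain rfl | rfl := honly D hDF (hDv.trans (Finset.insert_subset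
      (Finset.mem_union_left _ (Finset.mem_sdiff.1 hv).1) Finset.subset_union_right))
    · have hcard := Finset.card_le_card (show D \ B ⊆ {v} by grind)
      rw [Finset.card_singleton] at hcard
      omega
    · obtain ⟨k, hk, hLk⟩ := List.mem_take_iff_getElem.1 hDL
      have := (hL.getElem_inj_iff).1 (hLk.trans hLj.symm)
      omega
  obtain ⟨i, hi, hLi⟩ := List.getElem_of_mem ((hmem _).2 ⟨A, hA, rfl⟩)
  obtain ⟨j, hj, hLj⟩ := List.getElem_of_mem ((hmem _).2 ⟨B, hB, rfl⟩)
  rcases lt_trichotomy i j with hij | rfl | hij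
  · exact key A B hAB honly hA i j hi hj hLi hLj hij
  · have hEq := coverMonomial_injective K (hLi.symm.trans hLj)
    simp [hEq] at hAB
  · refine key B A hBA (fun D hD hDs => ?_) hB j i hj hi hLj hLi hij
    exact (honly D hD (by rwa [Finset.union_comm])).symm

theorem isCover_clutterC4_iff (C : Finset (Fin 4 × Fin 5)) :
    IsCover ClutterC4 C ↔ (∀ j : Fin 4, ∃ i : Fin 5, (j, i) ∈ C) ∧
      (∃ i, (![0, 1, 2, 2, 3] i, i) ∈ C) ∧ (∃ i, (![0, 0, 1, 1, 2] i, i) ∈ C) ∧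
      (∃ i, (![0, 0, 2, 2, 2] i, i) ∈ C) ∧ (∃ i, (![0, 1, 1, 1, 3] i, i) ∈ C) := by
  simp only [IsCover, ClutterC4, Set.mem_ofPred_eq, or_imp, forall_and, forall_eq,
    forall_exists_index]
  rw [forall_comm]
  simp only [forall_eq]

instance decidableIsCoverClutterC4 : DecidablePred (IsCover ClutterC4) := fun C =>
  decidable_of_iff' _ (isCover_clutterC4_iff C)

theorem IsCover.mono {g d : ℕ} {E : Set (Fin d → Fin g)} {C D : Finset (Fin g × Fin d)}
    (hC : IsCover E C) (h : C ⊆ D) : IsCover E D :=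
  fun f hf => (hC f hf).imp fun _ hi => h hi

theorem isMinCover_of_forall_erase {g d : ℕ} {E : Set (Fin d → Fin g)}
    {C : Finset (Fin g × Fin d)} (hC : IsCover E C) (h : ∀ v ∈ C, ¬ IsCover E (C.erase v)) :
    IsMinCover E C := by
  refine ⟨hC, fun C' hC' hcover => ?_⟩
  obtain ⟨v, hv, hsub⟩ := Finset.ssubset_iff_exists_subset_erase.1 hC'
  exact h v hv (hcover.mono hsub)

theorem IsMinCover.eq_of_subset {g d : ℕ} {E : Set (Fin d → Fin g)}
    {C D : Finset (Fin g × Fin d)} (hD : IsMinCover E D) (hC : IsCover E C) (h : C ⊆ D) :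
    D = C := by
  by_contra hne
  exact hD.2 C (h.ssubset_of_ne (Ne.symm hne)) hC

/-- The Alexander dual ideal of the clutter `𝒞₄` does not have linear quotients:
no enumeration of its minimal monomial generators has all the successive colon
ideals generated by variables. -/
theorem clutterC4_not_linear_quotients (K : Type*) [Field K] :
    ¬ HasLinearQuotients {u : MvPolynomial (Fin 4 × Fin 5) K |
        ∃ C : Finset (Fin 4 × Fin 5), IsMinCover ClutterC4 C ∧ u = CoverMonomial K C} := by
  have himage : {u : MvPolynomial (Fin 4 × Fin 5) K |
      ∃ C : Finset (Fin 4 × Fin 5), IsMinCover ClutterC4 C ∧ u = CoverMonomial K C} =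
      CoverMonomial K '' {C | IsMinCover ClutterC4 C} := by
    ext u
    simp [eq_comm]
  rw [himage]
  have hA : IsMinCover ClutterC4 {(0, 2), (1, 1), (2, 4), (3, 0)} :=
    isMinCover_of_forall_erase (by decide) (by decide)
  have hB : IsMinCover ClutterC4 {(0, 2), (1, 2), (2, 2), (3, 0)} :=
    isMinCover_of_forall_erase (by decide) (by decide)
  refine not_hasLinearQuotients_image_coverMonomial hA hB (by decide) (by decide)
    fun D hD hDs => ?_
  have hcontains : {(0, 2), (1, 1), (2, 4), (3, 0)} ⊆ D ∨
      {(0, 2), (1, 2), (2, 2), (3, 0)} ⊆ D := by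
    obtain ⟨hconst, hedge₁, hedge₂, -⟩ := (isCover_clutterC4_iff D).1 hD.1
    have hcol := fun j => (hconst j).imp fun _ hi => And.intro hi (hDs hi)
    replace hedge₁ := hedge₁.imp fun _ hi => And.intro hi (hDs hi)
    replace hedge₂ := hedge₂.imp fun _ hi => And.intro hi (hDs hi)
    simp [Fin.forall_fin_succ, Fin.exists_fin_succ] at hcol hedge₁ hedge₂
    simp only [Finset.insert_subset_iff, Finset.singleton_subset_iff]
    tauto
  exact hcontains.imp (hD.eq_of_subset hA.1) (hD.eq_of_subset hB.1)
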